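/- There exist an integer N and, for each 0 ≤ k ≤ r, an index j_k with p^k ≤ j_k ≤ q, such that for all n ≥ N the following hold: v(α_n) = C/q^n where C = q^N·v(α_N); and, writing Q^{(n)}(X) = P(X + α_n) − α_{n−1}, the coefficient of X^{p^k} in Q^{(n)} has valuation exactly M_k + E_k·C/q^n, where M_k = v(p)·v_p(C(j_k, p^k)) + v(P_{j_k}) and E_k = j_k − p^k. In particular the indices j_k, and hence the integers M_k and E_k, do not depend on n. -/

import Mathlib

open Filter in
/-- A finite family of affine functions with distinct slopes, evaluated along a nonzero sequence
`C / q ^ n` tending to zero, eventually has a strict minimum at a fixed index. -/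
theorem exists_eventually_strict_min {q : ℕ} (hq : 1 < q) {C : ℝ} (hC : C ≠ 0) {s : Finset ℕ}
    (hs : s.Nonempty) (M : ℕ → ℝ) :
    ∃ j ∈ s, ∀ᶠ n : ℕ in atTop, ∀ i ∈ s, i ≠ j →
      M j + (j : ℝ) * (C / (q : ℝ) ^ n) < M i + (i : ℝ) * (C / (q : ℝ) ^ n) := by
  obtain ⟨j, hj, hmin⟩ := s.exists_min_image (fun i ↦ toLex (M i, C * (i : ℝ))) hs
  refine ⟨j, hj, (Finset.eventually_all s).2 fun i hi ↦ ?_⟩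
  by_cases hij : i = j
  · exact Eventually.of_forall fun n h ↦ absurd hij h
  have hq0 : (0 : ℝ) < q := by exact_mod_cast (zero_lt_one.trans hq)
  rcases Prod.Lex.toLex_le_toLex.1 (hmin i hi) with h | ⟨h, h'⟩
  · have hlim : Tendsto (fun n : ℕ ↦ C / (q : ℝ) ^ n) atTop (nhds 0) :=
      tendsto_const_nhds.div_atTop
        (tendsto_pow_atTop_atTop_of_one_lt (by exact_mod_cast hq))
    have hlim (m : ℕ) : Tendsto (fun n : ℕ ↦ M m + (m : ℝ) * (C / (q : ℝ) ^ n)) atTop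
        (nhds (M m)) := by
      simpa using (hlim.const_mul (m : ℝ)).const_add (M m)
    filter_upwards [(hlim j).eventually_lt (hlim i) h] with n hn _ using hn
  · refine Eventually.of_forall fun n _ ↦ ?_
    have hne : C * (j : ℝ) ≠ C * (i : ℝ) := fun h ↦
      hij (by exact_mod_cast (mul_left_cancel₀ hC h).symm)
    have hlt : C * (j : ℝ) < C * (i : ℝ) := lt_of_le_of_ne h' hne
    have := div_lt_div_of_pos_right hlt (pow_pos hq0 n)
    simp only at h
    rw [h, ← mul_div_assoc, ← mul_div_assoc, mul_comm (j : ℝ), mul_comm (i : ℝ)]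
    linarith

/-- If each term of a real sequence is either `q` times the next one, when the next one is less
than `1 / (q - 1)`, or else exceeds it by at least `1`, then the sequence is eventually geometric. -/
theorem exists_forall_eq_mul_succ {q : ℝ} (hq : 1 < q) (a : ℕ → ℝ)
    (hlt : ∀ n, (q - 1) * a (n + 1) < 1 → a n = q * a (n + 1))
    (hge : ∀ n, 1 ≤ (q - 1) * a (n + 1) → 1 + a (n + 1) ≤ a n) :
    ∃ N, ∀ n, N ≤ n → a n = q * a (n + 1) := by
  obtain ⟨N, hN⟩ : ∃ N, (q - 1) * a N < 1 := by
    by_contra! h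
    have key (n : ℕ) : a n + n ≤ a 0 := by
      induction n with
      | zero => simp
      | succ n ih =>
        have := hge n (h (n + 1))
        push_cast
        linarith
    obtain ⟨n, hn⟩ := exists_nat_gt (a 0)
    have hpos : 0 < a n := by
      by_contra! hneg
      have := h n
      nlinarith
    linarith [key n]
  have hstep (n : ℕ) (hn : (q - 1) * a n < 1) : (q - 1) * a (n + 1) < 1 := by
    by_contra! h
    have := hge n h
    nlinarith
  have hall (n : ℕ) (hn : N ≤ n) : (q - 1) * a n < 1 := by
    induction n, hn using Nat.le_induction with
    | base => exact hN
    | succ n _ ih => exact hstep n ih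
  exact ⟨N, fun n hn ↦ hlt n (hstep n (hall n hn))⟩

theorem Polynomial.Monic.eval_eq_pow_add_sum {R : Type*} [CommSemiring R] {P : Polynomial R}
    (hP : P.Monic) (x : R) :
    P.eval x = x ^ P.natDegree + ∑ i ∈ Finset.range P.natDegree, P.coeff i * x ^ i := by
  conv_lhs => rw [hP.as_sum]
  simp [Polynomial.eval_finsetSum]

namespace AddValuation

variable {L : Type*} [Field L] (w : AddValuation L (WithTop ℝ))

theorem exists_coe_eq {x : L} (hx : x ≠ 0) : ∃ a : ℝ, w x = (a : WithTop ℝ) := by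
  obtain ⟨a, ha⟩ := WithTop.ne_top_iff_exists.1 (w.ne_top_iff.2 hx)
  exact ⟨a, ha.symm⟩

theorem map_pow_coe {x : L} {a : ℝ} (hx : w x = (a : WithTop ℝ)) (n : ℕ) :
    w (x ^ n) = ((n * a : ℝ) : WithTop ℝ) := by
  induction n with
  | zero => simp
  | succ n ih =>
    rw [pow_succ, w.map_mul, ih, hx, ← WithTop.coe_add]
    congr 1
    push_cast
    ring

theorem map_natCast_nonneg (n : ℕ) : 0 ≤ w (n : L) := by
  induction n with
  | zero => simp
  | succ n ih =>
    push_cast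
    exact w.map_le_add ih (by simp)

theorem map_intCast_nonneg (n : ℤ) : 0 ≤ w (n : L) := by
  obtain ⟨m, rfl | rfl⟩ := n.eq_nat_or_neg
  · simpa using w.map_natCast_nonneg m
  · simpa using w.map_natCast_nonneg m

theorem map_natCast_of_not_dvd {p : ℕ} (hp : p.Prime) (hw : 0 < w (p : L)) {m : ℕ}
    (hm : ¬p ∣ m) : w (m : L) = 0 := by
  refine le_antisymm (le_of_not_gt fun h ↦ ?_) (w.map_natCast_nonneg m)
  obtain ⟨a, b, hab⟩ := Int.isCoprime_iff_gcd_eq_one.2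
    (by simpa using (hp.coprime_iff_not_dvd.2 hm) : Int.gcd (p : ℤ) (m : ℤ) = 1)
  have h1 : (a : L) * (p : L) + (b : L) * (m : L) = 1 := by
    exact_mod_cast congrArg (Int.cast : ℤ → L) hab
  have : 0 < w ((a : L) * (p : L) + (b : L) * (m : L)) := by
    refine w.map_lt_add ?_ ?_
    · rw [w.map_mul]
      exact hw.trans_le (le_add_of_nonneg_left (w.map_intCast_nonneg a))
    · rw [w.map_mul]
      exact h.trans_le (le_add_of_nonneg_left (w.map_intCast_nonneg b))
  simp [h1] at this

theorem map_natCast_eq_padicValNat_mul {p : ℕ} (hp : p.Prime) {c : ℝ}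
    (hc : w (p : L) = (c : WithTop ℝ)) (hpos : 0 < w (p : L)) {n : ℕ} (hn : n ≠ 0) :
    w (n : L) = ((c * padicValNat p n : ℝ) : WithTop ℝ) := by
  have := Fact.mk hp
  obtain ⟨e, m, hm, rfl⟩ := Nat.exists_eq_pow_mul_and_not_dvd hn p hp.ne_one
  have hm0 : m ≠ 0 := fun h ↦ hm (h ▸ dvd_zero p)
  rw [padicValNat.mul (pow_ne_zero e hp.ne_zero) hm0, padicValNat.prime_pow,
    padicValNat.eq_zero_of_not_dvd hm]
  push_cast
  rw [w.map_mul, w.map_pow_coe hc, w.map_natCast_of_not_dvd hp hpos hm, add_zero]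
  simp [mul_comm]

theorem map_sum_eq_of_forall_lt {ι : Type*} {s : Finset ι} {f : ι → L} {i : ι} (hi : i ∈ s)
    (htop : w (f i) ≠ ⊤) (h : ∀ j ∈ s, j ≠ i → w (f i) < w (f j)) :
    w (∑ j ∈ s, f j) = w (f i) := by
  classical
  rw [← Finset.add_sum_erase s f hi]
  refine w.map_add_eq_of_lt_left (w.map_lt_sum htop fun j hj ↦ ?_)
  exact h j (Finset.mem_of_mem_erase hj) (Finset.ne_of_mem_erase hj)

theorem map_eval_of_mul_lt_one {P : Polynomial L} (hP : P.Monic) (h0 : P.coeff 0 = 0)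
    (hcoeff : ∀ i < P.natDegree, 1 ≤ w (P.coeff i)) {x : L} {a : ℝ} (hx : w x = (a : WithTop ℝ))
    (ha : ((P.natDegree : ℝ) - 1) * a < 1) :
    w (P.eval x) = ((P.natDegree * a : ℝ) : WithTop ℝ) := by
  rw [hP.eval_eq_pow_add_sum, ← w.map_pow_coe hx]
  refine w.map_add_eq_of_lt_left ?_
  rw [w.map_pow_coe hx]
  refine w.map_lt_sum (WithTop.coe_ne_top) fun i hi ↦ ?_
  rw [Finset.mem_range] at hi
  rcases Nat.eq_zero_or_pos i with rfl | hi0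
  · simpa [h0] using WithTop.coe_lt_top ((P.natDegree : ℝ) * a)
  rw [w.map_mul, w.map_pow_coe hx]
  refine lt_of_lt_of_le ?_ (add_le_add_left (hcoeff i hi) _)
  have : (P.natDegree : ℝ) * a < 1 + i * a := by
    have h1 : (1 : ℝ) ≤ i := by exact_mod_cast hi0
    have h2 : (i : ℝ) < P.natDegree := by exact_mod_cast hi
    rcases le_total a 0 with h | h <;> nlinarith
  exact_mod_cast this

theorem one_add_le_map_eval {P : Polynomial L} (hP : P.Monic) (h0 : P.coeff 0 = 0)
    (hcoeff : ∀ i < P.natDegree, 1 ≤ w (P.coeff i)) {x : L} {a : ℝ} (hx : w x = (a : WithTop ℝ))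
    (hq : 1 < P.natDegree) (ha : 1 ≤ ((P.natDegree : ℝ) - 1) * a) :
    ((1 + a : ℝ) : WithTop ℝ) ≤ w (P.eval x) := by
  have hq' : (1 : ℝ) < P.natDegree := by exact_mod_cast hq
  rw [hP.eval_eq_pow_add_sum]
  refine w.map_le_add ?_ (w.map_le_sum fun i hi ↦ ?_)
  · rw [w.map_pow_coe hx, WithTop.coe_le_coe]
    linarith
  rw [Finset.mem_range] at hi
  rcases Nat.eq_zero_or_pos i with rfl | hi0
  · simp [h0]
  rw [w.map_mul, w.map_pow_coe hx]
  refine le_trans ?_ (add_le_add_left (hcoeff i hi) _)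
  have h1 : (1 : ℝ) ≤ i := by exact_mod_cast hi0
  have h2 : 0 ≤ a := by
    by_contra! h
    nlinarith
  have : 1 + a ≤ 1 + i * a := by nlinarith
  exact_mod_cast this

end AddValuation

/-- The coefficients of positive degree of the shift `P(X + x) - y`. -/
theorem Polynomial.coeff_comp_X_add_C_sub_C {R : Type*} [CommRing R] (P : Polynomial R) (x y : R)
    {m : ℕ} (hm : m ≠ 0) :
    (P.comp (X + C x) - C y).coeff m =
      ∑ i ∈ P.support with m ≤ i, (i.choose m : R) * P.coeff i * x ^ (i - m) := by
  rw [coeff_sub, coeff_C_of_ne_zero hm, sub_zero, ← taylor_apply, taylor_coeff, hasseDeriv_apply,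
    sum_def, eval_finsetSum, Finset.sum_filter]
  refine Finset.sum_congr rfl fun i _ ↦ ?_
  split_ifs with h
  · simp
  · simp [Nat.choose_eq_zero_of_lt (not_le.1 h)]

/-- Stability of the Newton polygon data: there are `N ≥ 1` and indices `j k` (for
`0 ≤ k ≤ r`) with `p^k ≤ j k ≤ q` such that for all `n ≥ N`, `v (α n) = C/q^n` with
`C = q^N ⬝ v (α N)`, and the coefficient of `X^(p^k)` in `Q⁽ⁿ⁾(X) = P(X + α n) - α (n-1)`
has valuation exactly `M k + E k ⬝ C/q^n`, where
`M k = v(p) ⬝ v_p (C(j k, p^k)) + v (P_{j k})` and `E k = j k - p^k`. -/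
theorem stmt_12 (p r : ℕ) (hp : p.Prime) (hr : 1 ≤ r) (q : ℕ) (hq : q = p ^ r)
    (K : Type) [Field K] [CharZero K]
    (L : Type) [Field L] [Algebra K L] [IsAlgClosure K L]
    (v : L → WithTop ℝ)
    (hv0 : ∀ x : L, v x = ⊤ ↔ x = 0)
    (hvmul : ∀ x y : L, v (x * y) = v x + v y)
    (hvadd : ∀ x y : L, min (v x) (v y) ≤ v (x + y))
    (hdisc : ∀ x : K, x ≠ 0 → ∃ m : ℤ, v (algebraMap K L x) = ((m : ℝ) : WithTop ℝ))
    (hsurj : ∀ m : ℤ, ∃ x : K, v (algebraMap K L x) = ((m : ℝ) : WithTop ℝ))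
    (hcomplete : ∀ f : ℕ → K,
      (∀ C : ℝ, ∃ N : ℕ, ∀ m ≥ N, ∀ n ≥ N,
        ((C : ℝ) : WithTop ℝ) < v (algebraMap K L (f m - f n))) →
      ∃ x : K, ∀ C : ℝ, ∃ N : ℕ, ∀ n ≥ N,
        ((C : ℝ) : WithTop ℝ) < v (algebraMap K L (f n - x)))
    (hresp : 0 < v ((p : L)))
    (hperf : ∀ x : K, 0 ≤ v (algebraMap K L x) →
      ∃ y : K, 0 ≤ v (algebraMap K L y) ∧ 0 < v (algebraMap K L (x - y ^ p)))
    (P : Polynomial L) (hmonic : P.Monic) (hdeg : P.natDegree = q)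
    (hP0 : P.coeff 0 = 0)
    (hPK : ∀ i, ∃ c : K, 0 ≤ v (algebraMap K L c) ∧ P.coeff i = algebraMap K L c)
    (hPred : ∀ i < q, 0 < v (P.coeff i))
    (α : ℕ → L) (α₀ : K) (hα0 : α 0 = algebraMap K L α₀)
    (hbranch : ∀ n : ℕ, 1 ≤ n → P.eval (α n) = α (n - 1))
    (hv0α : v (α 0) ≠ 0) (hαne : ∀ n, α n ≠ 0) :
    ∃ N : ℕ, 1 ≤ N ∧ ∃ (j : ℕ → ℕ) (C vp : ℝ),
      v ((p : L)) = (vp : WithTop ℝ) ∧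
      (∀ k : ℕ, k ≤ r → p ^ k ≤ j k ∧ j k ≤ q) ∧
      ∀ n : ℕ, N ≤ n →
        v (α n) = ((C / q ^ n : ℝ) : WithTop ℝ) ∧
        ∀ k : ℕ, k ≤ r → ∃ vPj : ℝ,
          v (P.coeff (j k)) = (vPj : WithTop ℝ) ∧
          v ((P.comp (Polynomial.X + Polynomial.C (α n)) -
                Polynomial.C (α (n - 1))).coeff (p ^ k)) =
            ((vp * (padicValNat p ((j k).choose (p ^ k)) : ℝ) + vPj +
                ((j k : ℝ) - (p ^ k : ℕ)) * (C / q ^ n) : ℝ) : WithTop ℝ) := by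
  have hv1 : v 1 = 0 := by
    obtain ⟨a, ha⟩ := WithTop.ne_top_iff_exists.1 (mt (hv0 1).1 one_ne_zero)
    have h := hvmul 1 1
    rw [mul_one, ← ha, ← WithTop.coe_add, WithTop.coe_inj] at h
    rw [← ha, show a = 0 by linarith]
    rfl
  obtain ⟨w, rfl⟩ : ∃ w : AddValuation L (WithTop ℝ), v = w :=
    ⟨AddValuation.of v ((hv0 0).2 rfl) hv1 hvadd hvmul, rfl⟩
  have : CharZero L := charZero_of_injective_algebraMap (algebraMap K L).injective
  have hq1 : 1 < q := hq ▸ Nat.one_lt_pow (by omega) hp.one_lt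
  have hq1' : (1 : ℝ) < q := by exact_mod_cast hq1
  have hcoeff (i : ℕ) (hi : i < P.natDegree) : 1 ≤ w (P.coeff i) := by
    have hpos := hPred i (hdeg ▸ hi)
    obtain ⟨c, -, hc⟩ := hPK i
    rw [hc] at hpos ⊢
    by_cases hc0 : c = 0
    · simp [hc0]
    obtain ⟨m, hm⟩ := hdisc c hc0
    rw [hm] at hpos ⊢
    have hm0 : (0 : ℝ) < m := by exact_mod_cast hpos
    have hm1 : 1 ≤ m := by
      have : 0 < m := by exact_mod_cast hm0
      omega
    have : (1 : ℝ) ≤ m := by exact_mod_cast hm1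
    exact_mod_cast this
  choose a ha using fun n ↦ w.exists_coe_eq (hαne n)
  have heval (n : ℕ) : P.eval (α (n + 1)) = α n := hbranch (n + 1) (by omega)
  have hlt (n : ℕ) (h : ((q : ℝ) - 1) * a (n + 1) < 1) : a n = q * a (n + 1) := by
    have := w.map_eval_of_mul_lt_one hmonic hP0 hcoeff (ha (n + 1)) (hdeg ▸ h)
    rw [heval, ha, hdeg] at this
    exact_mod_cast this
  have hge (n : ℕ) (h : 1 ≤ ((q : ℝ) - 1) * a (n + 1)) : 1 + a (n + 1) ≤ a n := by
    have := w.one_add_le_map_eval hmonic hP0 hcoeff (ha (n + 1)) (hdeg ▸ hq1) (hdeg ▸ h)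
    rw [heval, ha] at this
    exact_mod_cast this
  have hane (n : ℕ) : a n ≠ 0 := by
    induction n with
    | zero =>
      intro h
      refine hv0α ?_
      rw [ha, h]
      rfl
    | succ n ih =>
      intro h
      refine ih ?_
      rw [hlt n (by simp [h]), h, mul_zero]
  obtain ⟨N₀, hN₀⟩ := exists_forall_eq_mul_succ hq1' a hlt hge
  set C : ℝ := q ^ N₀ * a N₀ with hC
  have hC0 : C ≠ 0 := mul_ne_zero (by positivity) (hane N₀)
  have haC (n : ℕ) (hn : N₀ ≤ n) : a n = C / q ^ n := by
    rw [eq_div_iff (by positivity)]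
    induction n, hn using Nat.le_induction with
    | base => rw [hC, mul_comm]
    | succ n hn ih =>
      rw [← ih, hN₀ n hn, pow_succ]
      ring
  obtain ⟨vp, hvp⟩ := w.exists_coe_eq (Nat.cast_ne_zero.2 hp.ne_zero : (p : L) ≠ 0)
  have hcoe (i : ℕ) : ∃ b : ℝ, P.coeff i ≠ 0 → w (P.coeff i) = (b : WithTop ℝ) := by
    by_cases h : P.coeff i = 0
    · exact ⟨0, fun h' ↦ absurd h h'⟩
    · exact (w.exists_coe_eq h).imp fun _ hb _ ↦ hb
  choose b hb using hcoe
  let M (k i : ℕ) : ℝ := vp * (padicValNat p (i.choose (p ^ k)) : ℝ) + b i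
  have hmin (k : ℕ) : ∃ j, k ≤ r → (P.coeff j ≠ 0 ∧ p ^ k ≤ j) ∧
      ∀ᶠ n : ℕ in Filter.atTop, ∀ i ∈ P.support.filter (p ^ k ≤ ·), i ≠ j →
        M k j + (j : ℝ) * (C / (q : ℝ) ^ n) < M k i + (i : ℝ) * (C / (q : ℝ) ^ n) := by
    by_cases hk : k ≤ r
    · have hne : (P.support.filter (p ^ k ≤ ·)).Nonempty := by
        refine ⟨q, ?_⟩
        rw [Finset.mem_filter, Polynomial.mem_support_iff, ← hdeg, hmonic.coeff_natDegree, hdeg, hq]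
        exact ⟨one_ne_zero, Nat.pow_le_pow_right hp.pos hk⟩
      obtain ⟨j, hj, h⟩ := exists_eventually_strict_min hq1 hC0 hne (M k)
      rw [Finset.mem_filter, Polynomial.mem_support_iff] at hj
      exact ⟨j, fun _ ↦ ⟨hj, h⟩⟩
    · exact ⟨0, fun h ↦ absurd h hk⟩
  choose j hj using hmin
  have hev : ∀ᶠ n : ℕ in Filter.atTop, ∀ k ∈ Finset.range (r + 1),
      ∀ i ∈ P.support.filter (p ^ k ≤ ·), i ≠ j k →
        M k (j k) + (j k : ℝ) * (C / (q : ℝ) ^ n) < M k i + (i : ℝ) * (C / (q : ℝ) ^ n) :=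
    (Finset.eventually_all _).2 fun k hk ↦ (hj k (Nat.lt_succ_iff.1 (Finset.mem_range.1 hk))).2
  obtain ⟨N₁, hN₁⟩ := Filter.eventually_atTop.1 hev
  refine ⟨max 1 (max N₀ N₁), le_max_left _ _, j, C, vp, hvp, fun k hk ↦ ⟨(hj k hk).1.2, ?_⟩,
    fun n hn ↦ ?_⟩
  · exact hdeg ▸ Polynomial.le_natDegree_of_ne_zero (hj k hk).1.1
  have hn₀ : N₀ ≤ n := by omega
  have hn₁ : N₁ ≤ n := by omega
  have hαn : w (α n) = ((C / q ^ n : ℝ) : WithTop ℝ) := by rw [ha, haC n hn₀]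
  refine ⟨hαn, fun k hk ↦ ⟨b (j k), hb _ (hj k hk).1.1, ?_⟩⟩
  have hterm (i : ℕ) (hi : P.coeff i ≠ 0) (hki : p ^ k ≤ i) :
      w ((i.choose (p ^ k) : L) * P.coeff i * α n ^ (i - p ^ k)) =
        ((M k i + ((i : ℝ) - (p ^ k : ℕ)) * (C / q ^ n) : ℝ) : WithTop ℝ) := by
    rw [w.map_mul, w.map_mul, hb i hi, w.map_pow_coe hαn,
      w.map_natCast_eq_padicValNat_mul hp hvp hresp (Nat.choose_pos hki).ne', Nat.cast_sub hki,
      ← WithTop.coe_add, ← WithTop.coe_add]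
  have hjk := (hj k hk).1
  rw [Polynomial.coeff_comp_X_add_C_sub_C P _ _ (pow_ne_zero k hp.ne_zero),
    w.map_sum_eq_of_forall_lt (i := j k) (by simpa using hjk), hterm _ hjk.1 hjk.2]
  · rw [hterm _ hjk.1 hjk.2]
    exact WithTop.coe_ne_top
  · intro i hi hij
    have hi' := Finset.mem_filter.1 hi
    rw [hterm _ hjk.1 hjk.2, hterm _ (Polynomial.mem_support_iff.1 hi'.1) hi'.2,
      WithTop.coe_lt_coe, sub_mul, sub_mul]
    have := hN₁ n hn₁ k (Finset.mem_range.2 (Nat.lt_succ_of_le hk)) i hi hij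
    linarith
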